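/- Let ω be the Cantor measure on [0,1], fix 0 < δ < 1/2, choose for each k ≥ 0 and 1 ≤ j ≤ 2^k a point z_j^k ∈ G_j^k whose distance to each endpoint of G_j^k is at least δ·|G_j^k|, and let σ = Σ_{k≥0} Σ_{j=1}^{2^k} (2/9)^k δ_{z_j^k}. Set ϵ₀ = 1/( (log 3 / log 2) − 1/2 ), so ϵ₀ ≈ 0.92 < 2. Then for every ϵ with ϵ₀ ≤ ϵ ≤ 2 there is a constant C (depending only on δ and ϵ) such that for every interval I ⊂ [0,1], σ(I) · E(I,σ)^ϵ · P(I,ω)² ≤ C · ω(I). -/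

import Mathlib

open MeasureTheory Set ENNReal

/-- The Poisson integral `P(I,ν)` of the interval `I = [a,b]`. -/
noncomputable def poisson (ν : Measure ℝ) (a b : ℝ) : ℝ≥0∞ :=
  ∫⁻ x, ENNReal.ofReal ((b - a) / ((b - a) + Metric.infDist x (Set.Icc a b)) ^ 2) ∂ν

/-- The square `E(I,ν)^2` of the energy of the interval `I = [a,b]`. -/
noncomputable def energySq (ν : Measure ℝ) (a b : ℝ) : ℝ≥0∞ :=
  (∫⁻ x in Set.Icc a b, ∫⁻ y in Set.Icc a b,
      ENNReal.ofReal (((x - y) / (b - a)) ^ 2) ∂ν ∂ν) / (2 * ν (Set.Icc a b) ^ 2)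

/-- The left endpoint of the generation-`k` triadic interval of the middle-thirds Cantor
construction determined by the digits `d`. -/
noncomputable def cantorLeft (k : ℕ) (d : Fin k → Bool) : ℝ :=
  ∑ i : Fin k, (cond (d i) 2 0) / 3 ^ ((i : ℕ) + 1)

/-- The generation-`k` closed triadic interval `I_d^k`, of length `3^{-k}`. -/
noncomputable def cantorI (k : ℕ) (d : Fin k → Bool) : Set ℝ :=
  Set.Icc (cantorLeft k d) (cantorLeft k d + (1/3) ^ k)

/-- The left endpoint of the removed open middle third `G_d^k` of `I_d^k`. -/
noncomputable def gLeft (k : ℕ) (d : Fin k → Bool) : ℝ :=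
  cantorLeft k d + (1/3) ^ (k + 1)

/-- The right endpoint of the removed open middle third `G_d^k` of `I_d^k`. -/
noncomputable def gRight (k : ℕ) (d : Fin k → Bool) : ℝ :=
  cantorLeft k d + 2 * (1/3) ^ (k + 1)

/-- `ω` is the Cantor measure on `[0,1]`: the unique Borel probability measure with
`ω(I_d^k) = 2^{-k}` for every `k ≥ 0` and every generation-`k` triadic interval. -/
def IsCantorMeasure (ω : Measure ℝ) : Prop :=
  IsProbabilityMeasure ω ∧
  ∀ (k : ℕ) (d : Fin k → Bool), ω (cantorI k d) = (1/2 : ℝ≥0∞) ^ k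

/-- The points `z_d^k ∈ G_d^k` lie at distance at least `δ·|G_d^k|` from both endpoints of
`G_d^k` (recall `|G_d^k| = 3^{-(k+1)}`). -/
def GoodPoints (δ : ℝ) (z : (k : ℕ) → (Fin k → Bool) → ℝ) : Prop :=
  ∀ (k : ℕ) (d : Fin k → Bool),
    gLeft k d + δ * (1/3) ^ (k + 1) ≤ z k d ∧ z k d ≤ gRight k d - δ * (1/3) ^ (k + 1)

/-- The measure `σ = Σ_{k,d} (2/9)^k δ_{z_d^k}`. -/
noncomputable def cantorSigma (z : (k : ℕ) → (Fin k → Bool) → ℝ) : Measure ℝ :=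
  Measure.sum fun p : Σ k : ℕ, Fin k → Bool =>
    ((2:ℝ≥0∞)/9) ^ p.1 • Measure.dirac (z p.1 p.2)

/-- The left endpoint of the generation-`n` triadic interval coded by the first `n` digits
of the infinite word `D`. -/
noncomputable def wordLeft (D : ℕ → Bool) (n : ℕ) : ℝ :=
  ∑ i ∈ Finset.range n, (cond (D i) 2 0) / 3 ^ (i + 1)

/-- The generation-`n` triadic interval coded by the first `n` digits of `D`. -/
noncomputable def wordI (D : ℕ → Bool) (n : ℕ) : Set ℝ :=
  Set.Icc (wordLeft D n) (wordLeft D n + (1/3) ^ n)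

/-- The restriction of an infinite word to its first `n` digits. -/
def wordPrefix (D : ℕ → Bool) (n : ℕ) : Fin n → Bool := fun i => D i

lemma exists_wordPrefix_eq {n : ℕ} (d : Fin n → Bool) : ∃ D, wordPrefix D n = d :=
  ⟨fun i => if h : i < n then d ⟨i, h⟩ else false, by ext i; simp [wordPrefix]⟩

lemma wordPrefix_congr {D D' : ℕ → Bool} {n : ℕ} (h : ∀ i < n, D i = D' i) :
    wordPrefix D n = wordPrefix D' n := by
  ext i
  simp [wordPrefix, h i i.2]

lemma cantorLeft_wordPrefix (D : ℕ → Bool) (n : ℕ) :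
    cantorLeft n (wordPrefix D n) = wordLeft D n :=
  Fin.sum_univ_eq_sum_range (fun i => ((cond (D i) 2 0) / 3 ^ (i + 1) : ℝ)) n

lemma cantorI_wordPrefix (D : ℕ → Bool) (n : ℕ) : cantorI n (wordPrefix D n) = wordI D n := by
  simp only [cantorI, wordI, cantorLeft_wordPrefix]

lemma measurableSet_wordI (D : ℕ → Bool) (n : ℕ) : MeasurableSet (wordI D n) :=
  measurableSet_Icc

lemma wordLeft_congr {D D' : ℕ → Bool} {n : ℕ} (h : ∀ i < n, D i = D' i) :
    wordLeft D n = wordLeft D' n :=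
  Finset.sum_congr rfl fun i hi => by rw [h i (Finset.mem_range.1 hi)]

lemma wordI_congr {D D' : ℕ → Bool} {n : ℕ} (h : ∀ i < n, D i = D' i) :
    wordI D n = wordI D' n := by
  simp only [wordI, wordLeft_congr h]

lemma wordLeft_succ_of_false {D : ℕ → Bool} {n : ℕ} (h : D n = false) :
    wordLeft D (n + 1) = wordLeft D n := by
  simp [wordLeft, Finset.sum_range_succ, h]

lemma wordLeft_succ_of_true {D : ℕ → Bool} {n : ℕ} (h : D n = true) :
    wordLeft D (n + 1) = wordLeft D n + 2 * (1/3) ^ (n + 1) := by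
  simp [wordLeft, Finset.sum_range_succ, h, div_eq_mul_inv]

lemma one_third_pow_succ (n : ℕ) : (1/3 : ℝ) ^ n = 3 * (1/3) ^ (n + 1) := by
  rw [pow_succ]; ring

lemma one_third_pow_pos (n : ℕ) : 0 < (1/3 : ℝ) ^ n := by positivity

lemma wordI_succ_subset (D : ℕ → Bool) (n : ℕ) : wordI D (n + 1) ⊆ wordI D n := by
  have h1 := one_third_pow_succ n
  have h2 := one_third_pow_pos (n + 1)
  cases h : D n
  · rw [wordI, wordI, wordLeft_succ_of_false h]
    exact Icc_subset_Icc le_rfl (by linarith)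
  · rw [wordI, wordI, wordLeft_succ_of_true h]
    exact Icc_subset_Icc (by linarith) (by linarith)

lemma wordI_antitone (D : ℕ → Bool) : Antitone (wordI D) :=
  antitone_nat_of_succ_le (wordI_succ_subset D)

lemma le_of_mem_wordI_succ_of_false {D : ℕ → Bool} {n : ℕ} {x : ℝ} (hx : x ∈ wordI D (n + 1))
    (h : D n = false) : x ≤ wordLeft D n + (1/3) ^ (n + 1) := by
  have := hx.2
  rwa [wordLeft_succ_of_false h] at this

lemma le_of_mem_wordI_succ_of_true {D : ℕ → Bool} {n : ℕ} {x : ℝ} (hx : x ∈ wordI D (n + 1))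
    (h : D n = true) : wordLeft D n + 2 * (1/3) ^ (n + 1) ≤ x := by
  have := hx.1
  rwa [wordLeft_succ_of_true h] at this

/-- Points of the two different children of an interval are separated by the middle third. -/
lemma le_abs_sub_of_mem_wordI {D D' : ℕ → Bool} {n : ℕ} (h : ∀ i < n, D i = D' i)
    (hn : D n ≠ D' n) {x y : ℝ} (hx : x ∈ wordI D (n + 1)) (hy : y ∈ wordI D' (n + 1)) :
    (1/3) ^ (n + 1) ≤ |x - y| := by
  have hL := wordLeft_congr h
  rw [le_abs]
  cases h1 : D n <;> cases h2 : D' n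
  · simp_all
  · right
    linarith [le_of_mem_wordI_succ_of_false hx h1, le_of_mem_wordI_succ_of_true hy h2]
  · left
    linarith [le_of_mem_wordI_succ_of_false hy h2, le_of_mem_wordI_succ_of_true hx h1]
  · simp_all

lemma exists_first_ne {D D' : ℕ → Bool} {n : ℕ} (h : ¬ ∀ i < n, D i = D' i) :
    ∃ m < n, (∀ i < m, D i = D' i) ∧ D m ≠ D' m := by
  have hex : ∃ i, i < n ∧ D i ≠ D' i := by
    push Not at h
    exact h
  classical
  refine ⟨Nat.find hex, (Nat.find_spec hex).1, fun i hi => ?_, (Nat.find_spec hex).2⟩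
  by_contra hne
  exact Nat.find_min hex hi ⟨hi.trans (Nat.find_spec hex).1, hne⟩

/-- The word that agrees with `D` below `n` and has digits `c`, `e`, `e`, … from place `n` on. -/
def wordExtend (D : ℕ → Bool) (n : ℕ) (c e : Bool) : ℕ → Bool :=
  fun i => if i < n then D i else if i = n then c else e

lemma wordExtend_of_lt (D : ℕ → Bool) {n i : ℕ} (c e : Bool) (h : i < n) :
    wordExtend D n c e i = D i := by
  simp [wordExtend, h]

lemma wordExtend_self (D : ℕ → Bool) (n : ℕ) (c e : Bool) : wordExtend D n c e n = c := by
  simp [wordExtend]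

lemma wordExtend_of_gt (D : ℕ → Bool) {n i : ℕ} (c e : Bool) (h : n < i) :
    wordExtend D n c e i = e := by
  have h1 : ¬ i < n := by omega
  have h2 : i ≠ n := by omega
  simp [wordExtend, h1, h2]

lemma wordLeft_add_of_true {D : ℕ → Bool} {K : ℕ} (h : ∀ i ≥ K, D i = true) {n : ℕ}
    (hn : K ≤ n) : wordLeft D n + (1/3) ^ n = wordLeft D K + (1/3) ^ K := by
  induction n, hn using Nat.le_induction with
  | base => rfl
  | succ n hn ih =>
    rw [wordLeft_succ_of_true (h n hn), ← ih, one_third_pow_succ n]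
    ring

lemma wordLeft_of_false {D : ℕ → Bool} {K : ℕ} (h : ∀ i ≥ K, D i = false) {n : ℕ}
    (hn : K ≤ n) : wordLeft D n = wordLeft D K := by
  induction n, hn using Nat.le_induction with
  | base => rfl
  | succ n hn ih => rw [wordLeft_succ_of_false (h n hn), ih]

namespace GoodPoints

variable {δ : ℝ} {z : (k : ℕ) → (Fin k → Bool) → ℝ}

lemma gap_le (hz : GoodPoints δ z) (D : ℕ → Bool) (k : ℕ) :
    wordLeft D k + (1/3) ^ (k + 1) + δ * (1/3) ^ (k + 1) ≤ z k (wordPrefix D k) ∧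
      z k (wordPrefix D k) ≤ wordLeft D k + 2 * (1/3) ^ (k + 1) - δ * (1/3) ^ (k + 1) := by
  have h := hz k (wordPrefix D k)
  rwa [gLeft, gRight, cantorLeft_wordPrefix] at h

lemma gap_lt (hz : GoodPoints δ z) (hδ : 0 < δ) (D : ℕ → Bool) (k : ℕ) :
    wordLeft D k + (1/3) ^ (k + 1) < z k (wordPrefix D k) ∧
      z k (wordPrefix D k) < wordLeft D k + 2 * (1/3) ^ (k + 1) := by
  have h := hz.gap_le D k
  have h1 : 0 < δ * (1/3) ^ (k + 1) := by positivity
  constructor <;> linarith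

lemma mem_wordI (hz : GoodPoints δ z) (hδ : 0 < δ) (D : ℕ → Bool) {n k : ℕ} (hn : n ≤ k) :
    z k (wordPrefix D k) ∈ wordI D n := by
  refine wordI_antitone D hn ?_
  have h := hz.gap_lt hδ D k
  have h1 := one_third_pow_succ k
  have h2 := one_third_pow_pos (k + 1)
  constructor <;> linarith

lemma notMem_wordI_succ (hz : GoodPoints δ z) (hδ : 0 < δ) {D D' : ℕ → Bool} {k : ℕ}
    (h : ∀ i < k, D i = D' i) : z k (wordPrefix D k) ∉ wordI D' (k + 1) := by
  intro hx
  have hg := hz.gap_lt hδ D k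
  have hL := wordLeft_congr h
  cases hk : D' k
  · linarith [le_of_mem_wordI_succ_of_false hx hk]
  · linarith [le_of_mem_wordI_succ_of_true hx hk]

lemma prefix_of_mem (hz : GoodPoints δ z) (hδ : 0 < δ) {D D' : ℕ → Bool} {n k : ℕ}
    (h : z k (wordPrefix D k) ∈ wordI D' n) : n ≤ k ∧ ∀ i < n, D i = D' i := by
  have key : ∀ i < n, i < k → D i = D' i := by
    by_contra hcon
    have hcon' : ¬ ∀ i < min n k, D i = D' i := fun hh =>
      hcon fun i h1 h2 => hh i (lt_min h1 h2)
    obtain ⟨m, hm, hlt, hne⟩ := exists_first_ne hcon'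
    obtain ⟨hmn, hmk⟩ := lt_min_iff.1 hm
    have h1 := le_abs_sub_of_mem_wordI hlt hne (hz.mem_wordI hδ D hmk)
      (wordI_antitone D' hmn h)
    rw [sub_self, abs_zero] at h1
    exact absurd (one_third_pow_pos (m + 1)) (not_lt.2 h1)
  have hnk : n ≤ k := by
    by_contra hlt
    have hlt : k < n := not_le.1 hlt
    exact hz.notMem_wordI_succ hδ (fun i hi => key i (hi.trans hlt) hi)
      (wordI_antitone D' hlt h)
  exact ⟨hnk, fun i hi => key i hi (hi.trans_le hnk)⟩

/-- If an interval contains no `z` of generation less than `k`, then all the `z` it contains have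
the same first `k` digits. -/
lemma prefix_of_forall_notMem (hz : GoodPoints δ z) (hδ : 0 < δ) {a b : ℝ} {k k' : ℕ}
    (hmin : ∀ j < k, ∀ D, z j (wordPrefix D j) ∉ Icc a b) {D D' : ℕ → Bool} (hk : k ≤ k')
    (h : z k (wordPrefix D k) ∈ Icc a b) (h' : z k' (wordPrefix D' k') ∈ Icc a b) :
    ∀ i < k, D i = D' i := by
  by_contra hcon
  obtain ⟨m, hm, hlt, hne⟩ := exists_first_ne hcon
  have hL := wordLeft_congr hlt
  have hg := hz.gap_lt hδ D m
  have hx := hz.mem_wordI hδ D (Nat.succ_le_of_lt hm)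
  have hx' := hz.mem_wordI hδ D' (Nat.succ_le_of_lt (hm.trans_le hk))
  refine hmin m hm D ?_
  cases h1 : D m <;> cases h2 : D' m
  · simp_all
  · have e1 := le_of_mem_wordI_succ_of_false hx h1
    have e2 := le_of_mem_wordI_succ_of_true hx' h2
    exact ⟨by linarith [h.1], by linarith [h'.2]⟩
  · have e1 := le_of_mem_wordI_succ_of_false hx' h2
    have e2 := le_of_mem_wordI_succ_of_true hx h1
    exact ⟨by linarith [h'.1], by linarith [h.2]⟩
  · simp_all

end GoodPoints

section CantorSigma

variable {δ : ℝ} {z : (k : ℕ) → (Fin k → Bool) → ℝ}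

lemma cantorSigma_apply (z : (k : ℕ) → (Fin k → Bool) → ℝ) {S : Set ℝ} (hS : MeasurableSet S) :
    cantorSigma z S =
      ∑' p : Σ k : ℕ, Fin k → Bool, ((2:ℝ≥0∞)/9) ^ p.1 * S.indicator 1 (z p.1 p.2) := by
  rw [cantorSigma, Measure.sum_apply _ hS]
  refine tsum_congr fun p => ?_
  rw [Measure.smul_apply, Measure.dirac_apply' _ hS, smul_eq_mul]

lemma cantorSigma_mono_of_points {S T : Set ℝ} (hS : MeasurableSet S) (hT : MeasurableSet T)
    (h : ∀ k D, z k (wordPrefix D k) ∈ S → z k (wordPrefix D k) ∈ T) :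
    cantorSigma z S ≤ cantorSigma z T := by
  rw [cantorSigma_apply z hS, cantorSigma_apply z hT]
  refine ENNReal.tsum_le_tsum fun ⟨k, d⟩ => ?_
  obtain ⟨D, rfl⟩ := exists_wordPrefix_eq d
  refine mul_le_mul_right ?_ _
  by_cases hd : z k (wordPrefix D k) ∈ S
  · rw [indicator_of_mem hd, indicator_of_mem (h k D hd)]
  · rw [indicator_of_notMem hd]
    exact zero_le

lemma exists_mem_of_cantorSigma_ne_zero {S : Set ℝ} (hS : MeasurableSet S)
    (h : cantorSigma z S ≠ 0) : ∃ k D, z k (wordPrefix D k) ∈ S := by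
  by_contra hcon
  push Not at hcon
  refine h (le_antisymm ?_ zero_le)
  rw [← measure_empty (μ := cantorSigma z)]
  exact cantorSigma_mono_of_points hS MeasurableSet.empty fun k D hk => absurd hk (hcon k D)

lemma pow_le_cantorSigma {S : Set ℝ} (hS : MeasurableSet S) {k : ℕ} {d : Fin k → Bool}
    (h : z k d ∈ S) : ((2:ℝ≥0∞)/9) ^ k ≤ cantorSigma z S := by
  rw [cantorSigma_apply z hS]
  refine le_trans ?_ (ENNReal.le_tsum ⟨k, d⟩)
  simp [h]

lemma card_wordPrefix_le (D : ℕ → Bool) (n i : ℕ) :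
    (Finset.univ.filter fun d : Fin (n + i) → Bool =>
      ∀ j : Fin n, d (Fin.castAdd i j) = D j).card ≤ 2 ^ i := by
  have h : (Finset.univ : Finset (Fin i → Bool)).card = 2 ^ i := by simp
  rw [← h]
  refine Finset.card_le_card_of_injOn (fun d j => d (Fin.natAdd n j)) (by simp) ?_
  intro d hd d' hd' hdd
  simp only [Finset.coe_filter, Finset.mem_univ, true_and, mem_ofPred_eq] at hd hd'
  ext j
  refine Fin.addCases (fun j => ?_) (fun j => ?_) j
  · rw [hd, hd']
  · have h := congrFun hdd j
    dsimp only at h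
    rw [h]

lemma two_ninths_ne_top : ((2:ℝ≥0∞)/9) ≠ ⊤ := ENNReal.div_ne_top (by norm_num) (by norm_num)

lemma two_ninths_ne_zero : ((2:ℝ≥0∞)/9) ≠ 0 := by simp

lemma tsum_four_ninths_le : ∑' i : ℕ, (2:ℝ≥0∞) ^ i * (2/9) ^ i ≤ 2 := by
  have h4 : (2:ℝ≥0∞) * (2/9) = ENNReal.ofReal (4/9) := by
    rw [← mul_div_assoc, ENNReal.ofReal_div_of_pos (by norm_num)]
    norm_num
  simp_rw [← mul_pow, h4]
  rw [ENNReal.tsum_geometric, ← ENNReal.ofReal_one, ← ENNReal.ofReal_sub _ (by norm_num),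
    ← ENNReal.ofReal_inv_of_pos (by norm_num)]
  refine (ENNReal.ofReal_le_ofReal (q := 2) (by norm_num)).trans (by simp)

lemma cantorSigma_wordI_le (hz : GoodPoints δ z) (hδ : 0 < δ) (D : ℕ → Bool) (n : ℕ) :
    cantorSigma z (wordI D n) ≤ 2 * ((2:ℝ≥0∞)/9) ^ n := by
  classical
  rw [cantorSigma_apply z (measurableSet_wordI D n), ENNReal.tsum_sigma (fun k (d : Fin k → Bool) =>
    ((2:ℝ≥0∞)/9) ^ k * (wordI D n).indicator 1 (z k d))]
  set f : ℕ → ℝ≥0∞ := fun k => ∑' d : Fin k → Bool,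
    ((2:ℝ≥0∞)/9) ^ k * (wordI D n).indicator 1 (z k d) with hf
  have h0 : ∀ k < n, f k = 0 := by
    intro k hk
    refine ENNReal.tsum_eq_zero.2 fun d => ?_
    obtain ⟨D', rfl⟩ := exists_wordPrefix_eq d
    have : z k (wordPrefix D' k) ∉ wordI D n := fun h =>
      absurd (hz.prefix_of_mem hδ h).1 (not_le.2 hk)
    simp [this]
  have h1 : ∀ i, f (n + i) ≤ ((2:ℝ≥0∞)/9) ^ n * (2 ^ i * (2/9) ^ i) := by
    intro i
    calc f (n + i) ≤ ∑ d : Fin (n + i) → Bool,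
          if ∀ j : Fin n, d (Fin.castAdd i j) = D j then ((2:ℝ≥0∞)/9) ^ (n + i) else 0 := by
          simp only [hf]
          rw [tsum_fintype]
          refine Finset.sum_le_sum fun d _ => ?_
          obtain ⟨D', rfl⟩ := exists_wordPrefix_eq d
          by_cases h : z (n + i) (wordPrefix D' (n + i)) ∈ wordI D n
          · have hp := (hz.prefix_of_mem hδ h).2
            have hp' : ∀ j : Fin n, wordPrefix D' (n + i) (Fin.castAdd i j) = D j :=
              fun j => hp j j.2
            rw [if_pos hp']
            simp [h]
          · simp [h]
      _ ≤ (2:ℝ≥0∞) ^ i * (2/9) ^ (n + i) := by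
          rw [← Finset.sum_filter, Finset.sum_const, nsmul_eq_mul]
          gcongr
          exact_mod_cast card_wordPrefix_le D n i
      _ = _ := by rw [pow_add]; ring
  calc ∑' k, f k = ∑' i, f (n + i) := by
        rw [← ENNReal.summable.sum_add_tsum_nat_add' (f := f) (k := n),
          Finset.sum_eq_zero fun k hk => h0 k (Finset.mem_range.1 hk), zero_add]
        simp_rw [add_comm]
    _ ≤ ∑' i, ((2:ℝ≥0∞)/9) ^ n * (2 ^ i * (2/9) ^ i) := ENNReal.tsum_le_tsum h1
    _ ≤ 2 * ((2:ℝ≥0∞)/9) ^ n := by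
        rw [ENNReal.tsum_mul_left, mul_comm]
        gcongr
        exact tsum_four_ninths_le

end CantorSigma

section Estimates

variable {δ : ℝ} {z : (k : ℕ) → (Fin k → Bool) → ℝ} {ω : Measure ℝ}

lemma IsCantorMeasure.wordI_eq (hω : IsCantorMeasure ω) (D : ℕ → Bool) (n : ℕ) :
    ω (wordI D n) = (1/2 : ℝ≥0∞) ^ n := by
  rw [← cantorI_wordPrefix]
  exact hω.2 n _

lemma exists_cantorSigma_le_of_chain (hz : GoodPoints δ z) (hδ : 0 < δ) {D : ℕ → Bool} {K : ℕ}
    {S : Set ℝ} (hS : MeasurableSet S) (hSK : S ⊆ wordI D K)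
    (hchain : ∀ n ≥ K, wordI D n ⊆ S ∨ S ⊆ wordI D n) :
    cantorSigma z S = 0 ∨
      ∃ m ≥ K, cantorSigma z S ≤ 2 * ((2:ℝ≥0∞)/9) ^ m ∧ wordI D (m + 1) ⊆ S := by
  classical
  refine or_iff_not_imp_left.2 fun h0 => ?_
  obtain ⟨j, D', hj⟩ := exists_mem_of_cantorSigma_ne_zero hS h0
  have hex : ∃ n, K ≤ n ∧ ¬ S ⊆ wordI D n := by
    refine ⟨max K (j + 1), le_max_left _ _, fun hsub => ?_⟩
    have h1 := (hz.prefix_of_mem hδ (hsub hj)).1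
    have h2 := le_max_right K (j + 1)
    omega
  obtain ⟨hK, hn⟩ := Nat.find_spec hex
  have hne : Nat.find hex ≠ K := fun h => hn (by rwa [h])
  obtain ⟨m, hm⟩ : ∃ m, Nat.find hex = m + 1 := ⟨Nat.find hex - 1, by omega⟩
  have hKm : K ≤ m := by omega
  have hSm : S ⊆ wordI D m := by
    by_contra hcon
    exact Nat.find_min hex (by omega : m < Nat.find hex) ⟨hKm, hcon⟩
  refine ⟨m, hKm, (measure_mono hSm).trans (cantorSigma_wordI_le hz hδ D m), ?_⟩
  rw [hm] at hn
  exact (hchain (m + 1) (by omega)).resolve_right hn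

/-- An interval anchored at an endpoint of the triadic interval `wordI D K` has `σ`-mass in it
controlled by a triadic interval of comparable size. -/
lemma exists_cantorSigma_le_of_anchored (hz : GoodPoints δ z) (hδ : 0 < δ) {D : ℕ → Bool}
    {K : ℕ} {a b : ℝ}
    (hD : ((∀ i ≥ K, D i = true) ∧ wordLeft D K + (1/3) ^ K ≤ b) ∨
      ((∀ i ≥ K, D i = false) ∧ a ≤ wordLeft D K)) :
    cantorSigma z (Icc a b ∩ wordI D K) = 0 ∨
      ∃ m ≥ K, cantorSigma z (Icc a b ∩ wordI D K) ≤ 2 * ((2:ℝ≥0∞)/9) ^ m ∧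
        wordI D (m + 1) ⊆ Icc a b := by
  have hchain : ∀ n ≥ K, wordI D n ⊆ Icc a b ∩ wordI D K ∨
      Icc a b ∩ wordI D K ⊆ wordI D n := by
    intro n hn
    rcases hD with ⟨h, hb⟩ | ⟨h, ha⟩
    · have hr := wordLeft_add_of_true h hn
      rcases le_total a (wordLeft D n) with hle | hle
      · refine Or.inl (subset_inter (Icc_subset_Icc hle (by linarith)) (wordI_antitone D hn))
      · exact Or.inr fun x hx => ⟨hle.trans hx.1.1, hx.2.2.trans hr.ge⟩
    · have hl := wordLeft_of_false h hn
      rcases le_total (wordLeft D n + (1/3) ^ n) b with hle | hle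
      · refine Or.inl (subset_inter (Icc_subset_Icc (by linarith) hle) (wordI_antitone D hn))
      · exact Or.inr fun x hx => ⟨hl.le.trans hx.2.1, hx.1.2.trans hle⟩
  rcases exists_cantorSigma_le_of_chain hz hδ (measurableSet_Icc.inter (measurableSet_wordI D K))
    inter_subset_right hchain with h | ⟨m, hm, h1, h2⟩
  · exact Or.inl h
  · exact Or.inr ⟨m, hm, h1, h2.trans inter_subset_left⟩

/-- Almost every point of `ω` lying in a triadic interval lies in one of its children. -/
lemma IsCantorMeasure.ae_mem_children (hω : IsCantorMeasure ω) (D : ℕ → Bool) (n : ℕ) :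
    ∀ᵐ x ∂ω, x ∈ wordI D n →
      x ∈ wordI (wordExtend D n false true) (n + 1) ∨
        x ∈ wordI (wordExtend D n true false) (n + 1) := by
  have := hω.1
  set A := wordI (wordExtend D n false true) (n + 1) with hA
  set B := wordI (wordExtend D n true false) (n + 1) with hB
  have hAn : A ⊆ wordI D n := by
    rw [← wordI_congr fun i hi => wordExtend_of_lt D false true hi]
    exact wordI_succ_subset _ _
  have hBn : B ⊆ wordI D n := by
    rw [← wordI_congr fun i hi => wordExtend_of_lt D true false hi]
    exact wordI_succ_subset _ _
  have hdisj : Disjoint A B := by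
    rw [Set.disjoint_left]
    intro x hxA hxB
    have h := le_abs_sub_of_mem_wordI (n := n)
      (fun i hi => by rw [wordExtend_of_lt D _ _ hi, wordExtend_of_lt D _ _ hi])
      (by simp [wordExtend_self]) hxA hxB
    rw [sub_self, abs_zero] at h
    exact absurd (one_third_pow_pos (n + 1)) (not_lt.2 h)
  have hmeas : MeasurableSet (A ∪ B) := (measurableSet_wordI _ _).union (measurableSet_wordI _ _)
  have hsum : ω (A ∪ B) = ω (wordI D n) := by
    rw [measure_union hdisj (measurableSet_wordI _ _), hω.wordI_eq, hω.wordI_eq, hω.wordI_eq,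
      pow_succ, ← mul_add, one_div, ENNReal.inv_two_add_inv_two, mul_one]
  have hnull : ω (wordI D n \ (A ∪ B)) = 0 := by
    rw [measure_sdiff (union_subset hAn hBn) hmeas.nullMeasurableSet (measure_ne_top ω _), hsum,
      tsub_self]
  filter_upwards [measure_eq_zero_iff_ae_notMem.1 hnull] with x hx hxn
  by_contra hcon
  exact hx ⟨hxn, hcon⟩

lemma IsCantorMeasure.ae_mem_wordI_zero (hω : IsCantorMeasure ω) (D : ℕ → Bool) :
    ∀ᵐ x ∂ω, x ∈ wordI D 0 := by
  have := hω.1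
  refine (mem_ae_iff_prob_eq_one (measurableSet_wordI D 0)).2 ?_
  simpa using hω.wordI_eq D 0

/-- `ω`-almost every point is at distance at least `δ 3^{-(n+1)}` from `z_d^k`, where `n ≤ k` is
some generation such that the point lies in the generation-`n` ancestor of `I_d^k`. -/
lemma GoodPoints.ae_exists_le_abs_sub (hz : GoodPoints δ z) (hδ : 0 < δ) (hδ1 : δ < 1/2)
    (hω : IsCantorMeasure ω) (D : ℕ → Bool) (k : ℕ) :
    ∀ᵐ x ∂ω, ∃ n ≤ k, x ∈ wordI D n ∧ δ * (1/3) ^ (n + 1) ≤ |x - z k (wordPrefix D k)| := by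
  have hall := ae_all_iff.2 fun n => hω.ae_mem_children D n
  filter_upwards [hω.ae_mem_wordI_zero D, hall] with x hx0 hx
  have hpos := one_third_pow_pos
  by_cases hk : x ∈ wordI D k
  · refine ⟨k, le_rfl, hk, ?_⟩
    have hg := hz.gap_le D k
    rw [le_abs]
    rcases hx k hk with h | h
    · have h1 := le_of_mem_wordI_succ_of_false h (wordExtend_self D k false true)
      rw [wordLeft_congr fun i hi => wordExtend_of_lt D false true hi] at h1
      right; linarith
    · have h1 := le_of_mem_wordI_succ_of_true h (wordExtend_self D k true false)
      rw [wordLeft_congr fun i hi => wordExtend_of_lt D true false hi] at h1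
      left; linarith
  · classical
    have hex : ∃ n, x ∉ wordI D n := ⟨k, hk⟩
    have hle : Nat.find hex ≤ k := Nat.find_min' hex hk
    have hspec := Nat.find_spec hex
    have hne : Nat.find hex ≠ 0 := fun h => hspec (h ▸ hx0)
    obtain ⟨n, hn⟩ : ∃ n, Nat.find hex = n + 1 := ⟨Nat.find hex - 1, by omega⟩
    have hxn : x ∈ wordI D n := not_not.1 (Nat.find_min hex (by omega : n < Nat.find hex))
    rw [hn] at hspec
    refine ⟨n, by omega, hxn, ?_⟩
    have hzn : z k (wordPrefix D k) ∈ wordI D (n + 1) := hz.mem_wordI hδ D (by omega)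
    have key : ∀ c e, x ∈ wordI (wordExtend D n c e) (n + 1) →
        (1/3) ^ (n + 1) ≤ |x - z k (wordPrefix D k)| := by
      intro c e h
      refine le_abs_sub_of_mem_wordI (fun i hi => wordExtend_of_lt D c e hi) (fun hc => ?_) h hzn
      refine hspec ?_
      rwa [wordI_congr (D' := D) fun i hi => ?_] at h
      rcases Nat.lt_succ_iff_lt_or_eq.1 hi with h' | rfl
      · exact wordExtend_of_lt D c e h'
      · exact hc
    have hsmall : δ * (1/3) ^ (n + 1) ≤ (1/3) ^ (n + 1) := by nlinarith [hpos (n + 1)]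
    exact hsmall.trans ((hx n hxn).elim (key _ _) (key _ _))

lemma poisson_integrand_le {a b x y : ℝ} (hy : y ∈ Icc a b) {r : ℝ} (hr : 0 < r)
    (h : r ≤ |x - y|) : (b - a) / ((b - a) + Metric.infDist x (Icc a b)) ^ 2 ≤ r⁻¹ := by
  have hd : |x - y| ≤ (b - a) + Metric.infDist x (Icc a b) := by
    have hne : (Icc a b).Nonempty := ⟨y, hy⟩
    obtain ⟨w, hw, hxw⟩ := isCompact_Icc.exists_infDist_eq_dist hne x
    rw [hxw, Real.dist_eq]
    have h1 : |w - y| ≤ b - a := abs_le.2 ⟨by linarith [hw.1, hy.2], by linarith [hw.2, hy.1]⟩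
    linarith [abs_sub_le x w y]
  have hinf : 0 ≤ Metric.infDist x (Icc a b) := Metric.infDist_nonneg
  set s := (b - a) + Metric.infDist x (Icc a b)
  have hs : 0 < s := hr.trans_le (h.trans hd)
  calc (b - a) / s ^ 2 ≤ s / s ^ 2 := by
        gcongr
        exact le_add_of_nonneg_right hinf
    _ = s⁻¹ := by field_simp
    _ ≤ r⁻¹ := inv_anti₀ hr (h.trans hd)

lemma sum_range_three_halves_le (k : ℕ) :
    ∑ n ∈ Finset.range (k + 1), (3/2 : ℝ) ^ n ≤ 3 * (3/2) ^ k := by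
  rw [geom_sum_eq (by norm_num), pow_succ]
  have : (0:ℝ) < (3/2) ^ k := by positivity
  rw [div_le_iff₀ (by norm_num)]
  linarith

lemma poisson_le (hz : GoodPoints δ z) (hδ : 0 < δ) (hδ1 : δ < 1/2) (hω : IsCantorMeasure ω)
    {a b : ℝ} {D : ℕ → Bool} {k : ℕ} (h : z k (wordPrefix D k) ∈ Icc a b) :
    poisson ω a b ≤ ENNReal.ofReal (9 / δ * (3/2) ^ k) := by
  calc poisson ω a b
      ≤ ∫⁻ x, ∑ n ∈ Finset.range (k + 1), (wordI D n).indicator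
          (fun _ => ENNReal.ofReal (3 / δ * 3 ^ n)) x ∂ω := by
        refine lintegral_mono_ae ?_
        filter_upwards [hz.ae_exists_le_abs_sub hδ hδ1 hω D k] with x hx
        obtain ⟨n, hn, hxn, hle⟩ := hx
        refine le_trans ?_ (Finset.single_le_sum (f := fun n => (wordI D n).indicator
          (fun _ => ENNReal.ofReal (3 / δ * 3 ^ n)) x) (fun _ _ => zero_le)
          (Finset.mem_range.2 (Nat.lt_succ_of_le hn)))
        simp only [indicator_of_mem hxn]
        refine ENNReal.ofReal_le_ofReal ?_
        refine (poisson_integrand_le h (by positivity) hle).trans (le_of_eq ?_)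
        rw [mul_inv, ← inv_pow, pow_succ]
        norm_num
        ring
    _ = ∑ n ∈ Finset.range (k + 1), ENNReal.ofReal (3 / δ * (3/2) ^ n) := by
        rw [lintegral_finsetSum _ fun n _ => measurable_const.indicator (measurableSet_wordI D n)]
        refine Finset.sum_congr rfl fun n _ => ?_
        have h2 : (1/2 : ℝ≥0∞) ^ n = ENNReal.ofReal ((1/2) ^ n) := by
          rw [ENNReal.ofReal_pow (by norm_num), ENNReal.ofReal_div_of_pos (by norm_num)]
          norm_num
        rw [lintegral_indicator_const (measurableSet_wordI D n), hω.wordI_eq, h2,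
          ← ENNReal.ofReal_mul (by positivity), mul_assoc, ← mul_pow]
        norm_num
    _ = ENNReal.ofReal (3 / δ * ∑ n ∈ Finset.range (k + 1), (3/2) ^ n) := by
        rw [Finset.mul_sum, ENNReal.ofReal_sum_of_nonneg fun n _ => by positivity]
    _ ≤ _ := by
        refine ENNReal.ofReal_le_ofReal ?_
        have h1 : (0:ℝ) < 3 / δ := by positivity
        calc 3 / δ * ∑ n ∈ Finset.range (k + 1), (3/2 : ℝ) ^ n ≤ 3 / δ * (3 * (3/2) ^ k) := by
              gcongr
              exact sum_range_three_halves_le k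
          _ = _ := by ring

/-- The energy is controlled by the proportion of mass away from any given point. -/
lemma energySq_le {ν : Measure ℝ} {a b : ℝ} (w : ℝ) (h0 : ν (Icc a b) ≠ 0)
    (htop : ν (Icc a b) ≠ ⊤) : energySq ν a b ≤ ν (Icc a b \ {w}) / ν (Icc a b) := by
  set s := ν (Icc a b) with hs
  set t := ν (Icc a b \ {w}) with ht
  set g : ℝ → ℝ≥0∞ := ({w}ᶜ : Set ℝ).indicator 1 with hg
  have hgm : Measurable g := measurable_one.indicator (measurableSet_singleton w).compl
  have hgint : ∫⁻ x in Icc a b, g x ∂ν = t := by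
    rw [hg, lintegral_indicator_one (measurableSet_singleton w).compl,
      Measure.restrict_apply (measurableSet_singleton w).compl, ht, sdiff_eq, inter_comm]
  have hbound : ∀ x ∈ Icc a b, ∀ y ∈ Icc a b,
      ENNReal.ofReal (((x - y) / (b - a)) ^ 2) ≤ g x + g y := by
    intro x hx y hy
    by_cases hxy : x = w ∧ y = w
    · simp [hxy.1, hxy.2]
    · have h1 : (1:ℝ≥0∞) ≤ g x + g y := by
        rcases not_and_or.1 hxy with h | h
        · have : g x = 1 := indicator_of_mem (by simpa using h) _
          rw [this]; exact le_self_add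
        · have : g y = 1 := indicator_of_mem (by simpa using h) _
          rw [this]; exact le_add_self
      refine le_trans ?_ h1
      rw [← ENNReal.ofReal_one]
      refine ENNReal.ofReal_le_ofReal ?_
      rw [sq_le_one_iff_abs_le_one, abs_div]
      refine div_le_one_of_le₀ ?_ (abs_nonneg _)
      refine le_trans ?_ (le_abs_self _)
      exact abs_le.2 ⟨by linarith [hx.1, hy.2], by linarith [hx.2, hy.1]⟩
  have hnum : ∫⁻ x in Icc a b, ∫⁻ y in Icc a b,
      ENNReal.ofReal (((x - y) / (b - a)) ^ 2) ∂ν ∂ν ≤ 2 * (t * s) := by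
    calc _ ≤ ∫⁻ x in Icc a b, ∫⁻ y in Icc a b, (g x + g y) ∂ν ∂ν :=
          setLIntegral_mono' measurableSet_Icc fun x hx =>
            setLIntegral_mono' measurableSet_Icc fun y hy => hbound x hx y hy
      _ = ∫⁻ x in Icc a b, (g x * s + t) ∂ν := by
          refine lintegral_congr fun x => ?_
          rw [lintegral_add_left measurable_const, hgint, setLIntegral_const]
      _ = 2 * (t * s) := by
          rw [lintegral_add_left (hgm.mul_const _), lintegral_mul_const _ hgm, hgint,
            setLIntegral_const, two_mul]
  calc energySq ν a b ≤ 2 * (t * s) / (2 * s ^ 2) := ENNReal.div_le_div_right hnum _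
    _ = t / s := by
        rw [ENNReal.mul_div_mul_left _ _ (by norm_num) (by norm_num), sq,
          ENNReal.mul_div_mul_right _ _ h0 htop]

lemma two_ninths_rpow_le {ϵ : ℝ} (hϵ0 : 1 / (Real.log 3 / Real.log 2 - 1/2) ≤ ϵ) :
    ((2:ℝ)/9) ^ (ϵ / 2) ≤ 1/2 := by
  have h2 : 0 < Real.log 2 := Real.log_pos (by norm_num)
  have h3 : Real.log 2 < Real.log 3 := Real.log_lt_log (by norm_num) (by norm_num)
  have hpos : 0 < Real.log 3 / Real.log 2 - 1/2 := by
    have := (one_lt_div h2).2 h3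
    linarith
  have key : Real.log 2 ≤ ϵ * (Real.log 3 - Real.log 2 / 2) := by
    rw [div_le_iff₀ hpos] at hϵ0
    calc Real.log 2 = 1 * Real.log 2 := (one_mul _).symm
      _ ≤ (ϵ * (Real.log 3 / Real.log 2 - 1/2)) * Real.log 2 := by gcongr
      _ = _ := by field_simp
  have hlog : Real.log (2/9) = Real.log 2 - 2 * Real.log 3 := by
    rw [Real.log_div (by norm_num) (by norm_num), show (9:ℝ) = 3 ^ 2 by norm_num, Real.log_pow]
    norm_num
  rw [Real.rpow_def_of_pos (by norm_num), ← Real.le_log_iff_exp_le (by norm_num), one_div,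
    Real.log_inv, hlog]
  linarith

lemma rpow_energy_le {ϵ : ℝ} (hϵ0 : 1 / (Real.log 3 / Real.log 2 - 1/2) ≤ ϵ) (hϵ2 : ϵ ≤ 2)
    (hϵpos : 0 < ϵ) {e : ℝ≥0∞} {i : ℕ} (he : e ≤ ENNReal.ofReal (4 * (2/9) ^ i)) :
    e ^ (ϵ / 2) ≤ ENNReal.ofReal (4 * (1/2) ^ i) := by
  refine (ENNReal.rpow_le_rpow he (by positivity)).trans ?_
  rw [ENNReal.ofReal_rpow_of_nonneg (by positivity) (by positivity)]
  refine ENNReal.ofReal_le_ofReal ?_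
  rw [Real.mul_rpow (by norm_num) (by positivity), ← Real.rpow_natCast, ← Real.rpow_mul (by norm_num),
    mul_comm (i : ℝ), Real.rpow_mul (by norm_num), Real.rpow_natCast]
  gcongr
  · exact Real.rpow_le_self_of_one_le (by norm_num) (by linarith)
  · exact two_ninths_rpow_le hϵ0

/-- The mass of `σ` away from the point of least generation in an interval decays in terms of the
`ω`-mass of the interval. -/
lemma exists_cantorSigma_diff_le (hz : GoodPoints δ z) (hδ : 0 < δ) {a b : ℝ} {k : ℕ}
    {D : ℕ → Bool} (hmin : ∀ j < k, ∀ D, z j (wordPrefix D j) ∉ Icc a b)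
    (h : z k (wordPrefix D k) ∈ Icc a b) :
    cantorSigma z (Icc a b \ {z k (wordPrefix D k)}) = 0 ∨
      ∃ i D', cantorSigma z (Icc a b \ {z k (wordPrefix D k)}) ≤ 4 * ((2:ℝ≥0∞)/9) ^ (k + i) ∧
        wordI D' (k + i + 1) ⊆ Icc a b := by
  set w := z k (wordPrefix D k) with hw
  set DL := wordExtend D k false true with hDL
  set DR := wordExtend D k true false with hDR
  have hg := hz.gap_lt hδ D k
  have hp := one_third_pow_pos (k + 1)
  have hsplit : cantorSigma z (Icc a b \ {w}) ≤
      cantorSigma z (Icc a b ∩ wordI DL (k + 1)) + cantorSigma z (Icc a b ∩ wordI DR (k + 1)) := by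
    refine le_trans (cantorSigma_mono_of_points
      (measurableSet_Icc.diff (measurableSet_singleton w))
      ((measurableSet_Icc.inter (measurableSet_wordI DL (k + 1))).union
        (measurableSet_Icc.inter (measurableSet_wordI DR (k + 1)))) ?_) (measure_union_le _ _)
    intro k' D' ⟨hI, hne⟩
    have hkk : k ≤ k' := not_lt.1 fun hlt => hmin k' hlt D' hI
    have hpre := hz.prefix_of_forall_notMem hδ hmin hkk h hI
    have hlt : k < k' := by
      refine lt_of_le_of_ne hkk fun heq => hne ?_
      subst heq
      rw [mem_singleton_iff, hw, wordPrefix_congr hpre]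
    have hmem := hz.mem_wordI hδ D' (Nat.succ_le_of_lt hlt)
    have hcongr : ∀ c e, D' k = c → wordI D' (k + 1) = wordI (wordExtend D k c e) (k + 1) := by
      intro c e hc
      refine wordI_congr fun i hi => ?_
      rcases Nat.lt_succ_iff_lt_or_eq.1 hi with h' | rfl
      · rw [wordExtend_of_lt D c e h', hpre i h']
      · rw [wordExtend_self, hc]
    cases hc : D' k
    · exact Or.inl ⟨hI, hcongr false true hc ▸ hmem⟩
    · exact Or.inr ⟨hI, hcongr true false hc ▸ hmem⟩
  have hL := exists_cantorSigma_le_of_anchored (a := a) (b := b) (D := DL) (K := k + 1) hz hδ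
    (Or.inl ⟨fun i hi => wordExtend_of_gt D _ _ hi, by
      rw [wordLeft_succ_of_false (wordExtend_self D k false true),
        wordLeft_congr fun i hi => wordExtend_of_lt D false true hi]
      exact hg.1.le.trans h.2⟩)
  have hR := exists_cantorSigma_le_of_anchored (a := a) (b := b) (D := DR) (K := k + 1) hz hδ
    (Or.inr ⟨fun i hi => wordExtend_of_gt D _ _ hi, by
      rw [wordLeft_succ_of_true (wordExtend_self D k true false),
        wordLeft_congr fun i hi => wordExtend_of_lt D true false hi]
      exact h.1.trans hg.2.le⟩)
  have h24 : ∀ m : ℕ, 2 * ((2:ℝ≥0∞)/9) ^ m ≤ 4 * (2/9) ^ m := fun m => by gcongr; norm_num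
  have hanti : ∀ {m n : ℕ}, m ≤ n → 2 * ((2:ℝ≥0∞)/9) ^ n ≤ 2 * (2/9) ^ m := fun {m n} hmn => by
    refine mul_le_mul_right (pow_le_pow_of_le_one zero_le ?_ hmn) _
    exact ENNReal.div_le_of_le_mul (by norm_num)
  have hsum : ∀ m : ℕ, 2 * ((2:ℝ≥0∞)/9) ^ m + 2 * (2/9) ^ m = 4 * (2/9) ^ m := fun m => by ring
  rcases hL with hL | ⟨m, hm, hL, hsubL⟩ <;> rcases hR with hR | ⟨m', hm', hR, hsubR⟩
  · rw [hL, hR, add_zero] at hsplit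
    exact Or.inl (le_antisymm hsplit zero_le)
  · obtain ⟨i, rfl⟩ := Nat.exists_eq_add_of_le (Nat.le_of_succ_le hm')
    rw [hL, zero_add] at hsplit
    exact Or.inr ⟨i, DR, hsplit.trans (hR.trans (h24 _)), hsubR⟩
  · obtain ⟨i, rfl⟩ := Nat.exists_eq_add_of_le (Nat.le_of_succ_le hm)
    rw [hR, add_zero] at hsplit
    exact Or.inr ⟨i, DL, hsplit.trans (hL.trans (h24 _)), hsubL⟩
  · obtain ⟨i, rfl⟩ := Nat.exists_eq_add_of_le (Nat.le_of_succ_le hm)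
    obtain ⟨i', rfl⟩ := Nat.exists_eq_add_of_le (Nat.le_of_succ_le hm')
    rcases le_total i i' with hii | hii
    · refine Or.inr ⟨i, DL, hsplit.trans ((add_le_add hL (hR.trans (hanti ?_))).trans_eq
        (hsum _)), hsubL⟩
      omega
    · refine Or.inr ⟨i', DR, hsplit.trans ((add_le_add (hL.trans (hanti ?_)) hR).trans_eq
        (hsum _)), hsubR⟩
      omega

lemma cantorSigma_Icc_le (hz : GoodPoints δ z) (hδ : 0 < δ) {a b : ℝ} {k : ℕ}
    {D : ℕ → Bool} (hmin : ∀ j < k, ∀ D, z j (wordPrefix D j) ∉ Icc a b)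
    (h : z k (wordPrefix D k) ∈ Icc a b) :
    cantorSigma z (Icc a b) ≤ 2 * ((2:ℝ≥0∞)/9) ^ k := by
  refine (cantorSigma_mono_of_points measurableSet_Icc (measurableSet_wordI D k) ?_).trans
    (cantorSigma_wordI_le hz hδ D k)
  intro k' D' hI
  have hkk : k ≤ k' := not_lt.1 fun hlt => hmin k' hlt D' hI
  rw [wordI_congr (hz.prefix_of_forall_notMem hδ hmin hkk h hI)]
  exact hz.mem_wordI hδ D' hkk

lemma ofReal_two_ninths_pow (n : ℕ) : ((2:ℝ≥0∞)/9) ^ n = ENNReal.ofReal ((2/9) ^ n) := by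
  rw [ENNReal.ofReal_pow (by norm_num), ENNReal.ofReal_div_of_pos (by norm_num)]
  norm_num

end Estimates

/-- **Dual energy estimate for the Cantor example.** With `ω` the Cantor measure,
`0 < δ < 1/2`, points `z_d^k ∈ G_d^k` at distance at least `δ|G_d^k|` from the endpoints of
`G_d^k`, `σ = Σ_{k,d} (2/9)^k δ_{z_d^k}`, and `ϵ₀ = 1/(log 3/log 2 - 1/2) ≈ 0.92 < 2`: for
every `ϵ₀ ≤ ϵ ≤ 2` there is `C = C(δ,ϵ)` such that for every interval `I = [a,b] ⊆ [0,1]`,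
`σ(I)·E(I,σ)^ϵ·P(I,ω)² ≤ C·ω(I)`. -/
theorem cantor_dual_energy_estimate (δ : ℝ) (hδ0 : 0 < δ) (hδ1 : δ < 1/2)
    (ϵ : ℝ) (hϵ0 : 1 / (Real.log 3 / Real.log 2 - 1/2) ≤ ϵ) (hϵ2 : ϵ ≤ 2) :
    ∃ C : ℝ, 0 < C ∧
      ∀ ω : Measure ℝ, IsCantorMeasure ω →
      ∀ z : (k : ℕ) → (Fin k → Bool) → ℝ, GoodPoints δ z →
      ∀ a b : ℝ, 0 ≤ a → a ≤ b → b ≤ 1 →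
        cantorSigma z (Set.Icc a b) * energySq (cantorSigma z) a b ^ (ϵ / 2) *
            poisson ω a b ^ 2
          ≤ ENNReal.ofReal C * ω (Set.Icc a b) := by
  have hϵpos : 0 < ϵ := by
    refine lt_of_lt_of_le (one_div_pos.2 ?_) hϵ0
    have h2 : 0 < Real.log 2 := Real.log_pos (by norm_num)
    have := (one_lt_div h2).2 (Real.log_lt_log (by norm_num) (by norm_num : (2:ℝ) < 3))
    linarith
  refine ⟨1296 / δ ^ 2, by positivity, fun ω hω z hz a b _ _ _ => ?_⟩
  classical
  by_cases hσ : cantorSigma z (Icc a b) = 0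
  · simp [hσ]
  have hex : ∃ k D, z k (wordPrefix D k) ∈ Icc a b :=
    exists_mem_of_cantorSigma_ne_zero measurableSet_Icc hσ
  obtain ⟨D, hD⟩ := Nat.find_spec hex
  have hmin : ∀ j < Nat.find hex, ∀ D, z j (wordPrefix D j) ∉ Icc a b :=
    fun j hj D' hD' => Nat.find_min hex hj ⟨D', hD'⟩
  generalize Nat.find hex = k at D hD hmin
  have hσle := cantorSigma_Icc_le hz hδ0 hmin hD
  have hσge := pow_le_cantorSigma measurableSet_Icc hD
  have hσtop : cantorSigma z (Icc a b) ≠ ⊤ :=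
    ne_top_of_le_ne_top (ENNReal.mul_ne_top (by norm_num) (ENNReal.pow_ne_top two_ninths_ne_top))
      hσle
  have hE := energySq_le (z k (wordPrefix D k)) hσ hσtop
  rcases exists_cantorSigma_diff_le hz hδ0 hmin hD with h0 | ⟨i, D', hdiff, hsub⟩
  · rw [h0, ENNReal.zero_div] at hE
    rw [le_antisymm hE zero_le, ENNReal.zero_rpow_of_pos (by positivity)]
    simp
  have hE' : energySq (cantorSigma z) a b ≤ ENNReal.ofReal (4 * (2/9) ^ i) := by
    refine hE.trans ((ENNReal.div_le_div hdiff hσge).trans_eq ?_)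
    rw [pow_add, ← mul_assoc, mul_right_comm, ENNReal.mul_div_cancel_right
      (pow_ne_zero k two_ninths_ne_zero) (ENNReal.pow_ne_top two_ninths_ne_top),
      ofReal_two_ninths_pow, ENNReal.ofReal_mul (by norm_num)]
    norm_num
  have hEpow := rpow_energy_le hϵ0 hϵ2 hϵpos hE'
  have hP := poisson_le hz hδ0 hδ1 hω hD
  have hωge : ENNReal.ofReal ((1/2) ^ (k + i + 1)) ≤ ω (Icc a b) := by
    refine le_trans (le_of_eq ?_) (measure_mono hsub)
    rw [hω.wordI_eq, ENNReal.ofReal_pow (by norm_num), ENNReal.ofReal_div_of_pos (by norm_num)]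
    norm_num
  have h2 : 2 * ((2:ℝ≥0∞)/9) ^ k = ENNReal.ofReal (2 * (2/9) ^ k) := by
    rw [ofReal_two_ninths_pow, ENNReal.ofReal_mul (by norm_num)]
    norm_num
  rw [h2] at hσle
  calc _ ≤ ENNReal.ofReal (2 * (2/9) ^ k) * ENNReal.ofReal (4 * (1/2) ^ i) *
        ENNReal.ofReal (9 / δ * (3/2) ^ k) ^ 2 := by gcongr
    _ = ENNReal.ofReal (1296 / δ ^ 2) * ENNReal.ofReal ((1/2) ^ (k + i + 1)) := by
        rw [← ENNReal.ofReal_pow (by positivity), ← ENNReal.ofReal_mul (by positivity),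
          ← ENNReal.ofReal_mul (by positivity), ← ENNReal.ofReal_mul (by positivity)]
        congr 1
        have h9 : ((1:ℝ)/2) ^ k = (2/9) ^ k * ((3/2) ^ k) ^ 2 := by
          rw [← pow_mul, mul_comm k 2, pow_mul, ← mul_pow]
          norm_num
        rw [pow_succ _ (k + i), pow_add, h9]
        ring
    _ ≤ _ := by gcongr
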